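/- There exists a constant C > 0, depending only on C₀ and λ, such that for every ε ∈ (0, 1], every discount rate δ ∈ (0, λ], every triple (α, β, γ) ∈ 𝓔(δ, λ, C₀) with α(0) + γ(0) ≤ 1, and every t ≥ 2/ε, one has e^{−δt}(α(t) + γ(t)) ≤ C (e^{−λ/ε} + ε^{1/2}). -/

import Mathlib

open MeasureTheory

/-- `f` is càdlàg on `[0, ∞)`: right-continuous at every `t ≥ 0` and
with a (finite) left limit at every `t > 0`. -/
def CadlagOnIci (f : ℝ → ℝ) : Prop :=
  (∀ t : ℝ, 0 ≤ t → Filter.Tendsto f (nhdsWithin t (Set.Ioi t)) (nhds (f t))) ∧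
  (∀ t : ℝ, 0 < t → ∃ L : ℝ, Filter.Tendsto f (nhdsWithin t (Set.Iio t)) (nhds L))

/-- The discounted class `𝓔(δ, λ, C₀)` of triples of nonnegative bounded càdlàg
functions on `[0, ∞)` satisfying the four structural inequalities. -/
structure MemED (δ lam C₀ : ℝ) (α β γ : ℝ → ℝ) : Prop where
  cadlag_alpha : CadlagOnIci α
  cadlag_beta : CadlagOnIci β
  cadlag_gamma : CadlagOnIci γ
  nonneg_alpha : ∀ t : ℝ, 0 ≤ t → 0 ≤ α t
  nonneg_beta : ∀ t : ℝ, 0 ≤ t → 0 ≤ β t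
  nonneg_gamma : ∀ t : ℝ, 0 ≤ t → 0 ≤ γ t
  bdd_alpha : ∃ M : ℝ, ∀ t : ℝ, 0 ≤ t → α t ≤ M
  bdd_beta : ∃ M : ℝ, ∀ t : ℝ, 0 ≤ t → β t ≤ M
  bdd_gamma : ∃ M : ℝ, ∀ t : ℝ, 0 ≤ t → γ t ≤ M
  ineq1 : ∀ t₁ : ℝ, 0 ≤ t₁ →
    (∫ t in Set.Ioi t₁, Real.exp (-δ * t) * β t) ≤
      C₀ * Real.exp (-δ * t₁) * Real.sqrt (α t₁ * γ t₁)
  ineq2 : ∀ t₁ t₂ : ℝ, 0 ≤ t₁ → t₁ ≤ t₂ →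
    γ t₂ ≤ C₀ * Real.exp (-lam * (t₂ - t₁)) * γ t₁ + C₀ * ∫ t in t₁..t₂, β t
  ineq3 : ∀ t₁ : ℝ, 0 ≤ t₁ →
    α t₁ ≤ C₀ * (∫ t in Set.Ioi t₁, Real.exp (-lam * (t - t₁)) * β t)
      + C₀ * sSup ((fun t => Real.exp (-lam * (t - t₁)) * γ t) '' Set.Ici t₁)
  ineq4 : ∀ t : ℝ, 0 ≤ t → α t ≤ C₀ * β t

theorem CadlagOnIci.measurable_comp_max {f : ℝ → ℝ} (hf : CadlagOnIci f) :
    Measurable fun t => f (max t 0) := by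
  have hpos : ∀ n : ℕ, (0 : ℝ) < n + 1 := fun n => by positivity
  refine measurable_of_tendsto_metrizable
    (f := fun (n : ℕ) t => f ((⌊((n : ℝ) + 1) * max t 0⌋ + 1) / ((n : ℝ) + 1))) ?_ ?_
  · intro n
    have hfloor : Measurable fun t : ℝ => ⌊((n : ℝ) + 1) * max t 0⌋ :=
      Int.measurable_floor.comp (by fun_prop)
    exact (measurable_from_top (f := fun k : ℤ => f ((k + 1) / ((n : ℝ) + 1)))).comp hfloor
  · rw [tendsto_pi_nhds]
    intro t
    refine (hf.1 _ (le_max_right t 0)).comp (tendsto_nhdsWithin_iff.2 ⟨?_, ?_⟩)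
    · have hlim : Filter.Tendsto (fun n : ℕ => max t 0 + 1 / ((n : ℝ) + 1)) Filter.atTop
          (nhds (max t 0)) := by
        simpa using tendsto_one_div_add_atTop_nhds_zero_nat.const_add (max t 0)
      refine tendsto_of_tendsto_of_tendsto_of_le_of_le tendsto_const_nhds hlim ?_ ?_
      · intro n
        have := Int.lt_floor_add_one (((n : ℝ) + 1) * max t 0)
        simp only [le_div_iff₀ (hpos n)]
        linarith
      · intro n
        have := Int.floor_le (((n : ℝ) + 1) * max t 0)
        have h : max t 0 + 1 / ((n : ℝ) + 1) = (((n : ℝ) + 1) * max t 0 + 1) / (n + 1) := by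
          field_simp
        simp only [h]
        gcongr
    · refine Filter.Eventually.of_forall fun n => ?_
      have := Int.lt_floor_add_one (((n : ℝ) + 1) * max t 0)
      simp only [Set.mem_Ioi, lt_div_iff₀ (hpos n)]
      linarith

namespace MemED

variable {δ lam C₀ : ℝ} {α β γ : ℝ → ℝ}

theorem integrableOn_discounted_beta (h : MemED δ lam C₀ α β γ) (hδ : 0 < δ) {s : ℝ}
    (hs : 0 ≤ s) : IntegrableOn (fun t => Real.exp (-δ * t) * β t) (Set.Ioi s) := by
  obtain ⟨M, hM⟩ := h.bdd_beta
  have hexp : IntegrableOn (fun t => M * Real.exp (-δ * t)) (Set.Ioi s) :=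
    (integrableOn_exp_mul_Ioi (neg_lt_zero.2 hδ) s).const_mul M
  refine Integrable.mono' hexp ?_ ?_
  · have hmeas : Measurable fun t => Real.exp (-δ * t) * β (max t 0) :=
      (by fun_prop : Measurable fun t : ℝ => Real.exp (-δ * t)).mul
        h.cadlag_beta.measurable_comp_max
    refine hmeas.aestronglyMeasurable.congr ?_
    filter_upwards [ae_restrict_mem measurableSet_Ioi] with t ht
    rw [max_eq_left (hs.trans (le_of_lt ht))]
  · filter_upwards [ae_restrict_mem measurableSet_Ioi] with t ht
    have ht0 : 0 ≤ t := hs.trans (le_of_lt ht)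
    rw [Real.norm_of_nonneg (mul_nonneg (Real.exp_pos _).le (h.nonneg_beta t ht0)), mul_comm]
    exact mul_le_mul_of_nonneg_right (hM t ht0) (Real.exp_pos _).le

theorem intervalIntegrable_beta (h : MemED δ lam C₀ α β γ) (hδ : 0 < δ) {s t : ℝ}
    (hs : 0 ≤ s) (hst : s ≤ t) : IntervalIntegrable β volume s t := by
  have hb : IntervalIntegrable (fun t => Real.exp (-δ * t) * β t) volume s t :=
    (intervalIntegrable_iff_integrableOn_Ioc_of_le hst).2
      ((h.integrableOn_discounted_beta hδ hs).mono_set Set.Ioc_subset_Ioi_self)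
  have := hb.continuousOn_mul (g := fun t => Real.exp (δ * t)) (by fun_prop)
  refine this.congr fun x _ => ?_
  simp [← mul_assoc, ← Real.exp_add]

theorem discounted_ineq1 (h : MemED δ lam C₀ α β γ) {s : ℝ} (hs : 0 ≤ s) :
    (∫ r in Set.Ioi s, Real.exp (-δ * r) * β r) ≤
      C₀ * √((Real.exp (-δ * s) * α s) * (Real.exp (-δ * s) * γ s)) := by
  have hsq : (Real.exp (-δ * s) * α s) * (Real.exp (-δ * s) * γ s) =
      Real.exp (-δ * s) ^ 2 * (α s * γ s) := by ring
  rw [hsq, Real.sqrt_mul (sq_nonneg _), Real.sqrt_sq (Real.exp_pos _).le, ← mul_assoc]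
  exact h.ineq1 s hs

theorem discounted_ineq2 (h : MemED δ lam C₀ α β γ) (hδ : 0 < δ) (hC₀ : 0 < C₀) {s t : ℝ}
    (hs : 0 ≤ s) (hst : s ≤ t) :
    Real.exp (-δ * t) * γ t ≤ C₀ * Real.exp (-lam * (t - s)) * (Real.exp (-δ * s) * γ s) +
      C₀ * ∫ r in Set.Ioi s, Real.exp (-δ * r) * β r := by
  have hb := h.integrableOn_discounted_beta hδ hs
  have hint : Real.exp (-δ * t) * ∫ r in s..t, β r ≤
      ∫ r in Set.Ioi s, Real.exp (-δ * r) * β r := by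
    calc Real.exp (-δ * t) * ∫ r in s..t, β r
        = ∫ r in s..t, Real.exp (-δ * t) * β r := by
          rw [intervalIntegral.integral_const_mul]
      _ ≤ ∫ r in s..t, Real.exp (-δ * r) * β r := by
          refine intervalIntegral.integral_mono_on hst
            ((h.intervalIntegrable_beta hδ hs hst).const_mul _)
            ((intervalIntegrable_iff_integrableOn_Ioc_of_le hst).2
              (hb.mono_set Set.Ioc_subset_Ioi_self)) fun r hr => ?_
          refine mul_le_mul_of_nonneg_right (Real.exp_le_exp.2 ?_)
            (h.nonneg_beta r (hs.trans hr.1))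
          nlinarith [hr.2]
      _ ≤ ∫ r in Set.Ioi s, Real.exp (-δ * r) * β r := by
          rw [intervalIntegral.integral_of_le hst]
          refine setIntegral_mono_set hb ?_ Set.Ioc_subset_Ioi_self.eventuallyLE
          filter_upwards [ae_restrict_mem measurableSet_Ioi] with r hr
          exact mul_nonneg (Real.exp_pos _).le (h.nonneg_beta r (hs.trans (le_of_lt hr)))
  have hexp : Real.exp (-δ * t) ≤ Real.exp (-δ * s) := Real.exp_le_exp.2 (by nlinarith)
  calc Real.exp (-δ * t) * γ t
      ≤ Real.exp (-δ * t) *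
          (C₀ * Real.exp (-lam * (t - s)) * γ s + C₀ * ∫ r in s..t, β r) := by
        gcongr
        exact h.ineq2 s t hs hst
    _ = C₀ * Real.exp (-lam * (t - s)) * (Real.exp (-δ * t) * γ s) +
          C₀ * (Real.exp (-δ * t) * ∫ r in s..t, β r) := by ring
    _ ≤ _ := by
        have := h.nonneg_gamma s hs
        gcongr

theorem discounted_ineq3 (h : MemED δ lam C₀ α β γ) (hδ : 0 < δ) (hδlam : δ ≤ lam)
    (hC₀ : 0 < C₀) {s : ℝ} (hs : 0 ≤ s) :
    Real.exp (-δ * s) * α s ≤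
      (C₀ + C₀ ^ 2) * (∫ r in Set.Ioi s, Real.exp (-δ * r) * β r) +
        C₀ ^ 2 * (Real.exp (-δ * s) * γ s) := by
  set B := ∫ r in Set.Ioi s, Real.exp (-δ * r) * β r
  have hexp : ∀ r, s ≤ r →
      Real.exp (-lam * (r - s)) ≤ Real.exp (δ * s) * Real.exp (-δ * r) := by
    intro r hr
    rw [← Real.exp_add]
    exact Real.exp_le_exp.2 (by nlinarith)
  have hone : Real.exp (-δ * s) * Real.exp (δ * s) = 1 := by simp [← Real.exp_add]
  have hint : (∫ r in Set.Ioi s, Real.exp (-lam * (r - s)) * β r) ≤ Real.exp (δ * s) * B := by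
    rw [← integral_const_mul]
    refine integral_mono_of_nonneg ?_
      ((h.integrableOn_discounted_beta hδ hs).const_mul _) ?_
    · filter_upwards [ae_restrict_mem measurableSet_Ioi] with r hr
      exact mul_nonneg (Real.exp_pos _).le (h.nonneg_beta r (hs.trans (le_of_lt hr)))
    · filter_upwards [ae_restrict_mem measurableSet_Ioi] with r hr
      rw [← mul_assoc]
      exact mul_le_mul_of_nonneg_right (hexp r (le_of_lt hr))
        (h.nonneg_beta r (hs.trans (le_of_lt hr)))
  have hsup : sSup ((fun t => Real.exp (-lam * (t - s)) * γ t) '' Set.Ici s) ≤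
      Real.exp (δ * s) * (C₀ * (Real.exp (-δ * s) * γ s) + C₀ * B) := by
    refine csSup_le (Set.nonempty_Ici.image _) ?_
    rintro _ ⟨r, hr : s ≤ r, rfl⟩
    have hγ := h.nonneg_gamma r (hs.trans hr)
    have hγs := mul_nonneg (Real.exp_pos (-δ * s)).le (h.nonneg_gamma s hs)
    have hle : Real.exp (-lam * (r - s)) ≤ 1 := Real.exp_le_one_iff.2 (by nlinarith)
    calc Real.exp (-lam * (r - s)) * γ r
        ≤ Real.exp (δ * s) * Real.exp (-δ * r) * γ r := by gcongr; exact hexp r hr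
      _ = Real.exp (δ * s) * (Real.exp (-δ * r) * γ r) := by ring
      _ ≤ Real.exp (δ * s) * (C₀ * Real.exp (-lam * (r - s)) * (Real.exp (-δ * s) * γ s) +
            C₀ * B) := by
          gcongr
          exact h.discounted_ineq2 hδ hC₀ hs hr
      _ ≤ Real.exp (δ * s) * (C₀ * 1 * (Real.exp (-δ * s) * γ s) + C₀ * B) := by gcongr
      _ = _ := by ring
  calc Real.exp (-δ * s) * α s
      ≤ Real.exp (-δ * s) * (C₀ * (Real.exp (δ * s) * B) +
          C₀ * (Real.exp (δ * s) * (C₀ * (Real.exp (-δ * s) * γ s) + C₀ * B))) := by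
        gcongr
        exact (h.ineq3 s hs).trans (by gcongr)
    _ = (Real.exp (-δ * s) * Real.exp (δ * s)) *
          (C₀ * B + C₀ * (C₀ * (Real.exp (-δ * s) * γ s) + C₀ * B)) := by ring
    _ = _ := by rw [hone]; ring

theorem alpha_le_mul_gamma (h : MemED δ lam C₀ α β γ) (hδ : 0 < δ) (hδlam : δ ≤ lam)
    (hC₀ : 0 < C₀) {s : ℝ} (hs : 0 ≤ s) :
    Real.exp (-δ * s) * α s ≤
      ((C₀ ^ 2 + C₀ ^ 3) ^ 2 + 2 * C₀ ^ 2) * (Real.exp (-δ * s) * γ s) := by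
  have h1 := h.discounted_ineq1 hs
  have h3 := h.discounted_ineq3 hδ hδlam hC₀ hs
  have ha := mul_nonneg (Real.exp_pos (-δ * s)).le (h.nonneg_alpha s hs)
  have hg := mul_nonneg (Real.exp_pos (-δ * s)).le (h.nonneg_gamma s hs)
  set a := Real.exp (-δ * s) * α s
  set g := Real.exp (-δ * s) * γ s
  rw [Real.sqrt_mul ha] at h1
  have h4 := mul_le_mul_of_nonneg_left h1 (by positivity : 0 ≤ C₀ + C₀ ^ 2)
  have h5 := sq_nonneg (√a - (C₀ ^ 2 + C₀ ^ 3) * √g)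
  have h6 := Real.sq_sqrt ha
  have h7 := Real.sq_sqrt hg
  have h8 : (√a - (C₀ ^ 2 + C₀ ^ 3) * √g) ^ 2 =
      a - 2 * ((C₀ + C₀ ^ 2) * (C₀ * (√a * √g))) + (C₀ ^ 2 + C₀ ^ 3) ^ 2 * g := by
    linear_combination h6 + (C₀ ^ 2 + C₀ ^ 3) ^ 2 * h7
  linarith

theorem integral_discounted_beta_le (h : MemED δ lam C₀ α β γ) (hC₀ : 0 < C₀)
    (h0 : α 0 + γ 0 ≤ 1) : (∫ r in Set.Ioi 0, Real.exp (-δ * r) * β r) ≤ C₀ := by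
  have ha := h.nonneg_alpha 0 le_rfl
  have hg := h.nonneg_gamma 0 le_rfl
  refine (h.discounted_ineq1 le_rfl).trans (mul_le_of_le_one_right hC₀.le ?_)
  rw [Real.sqrt_le_iff]
  simp only [mul_zero, Real.exp_zero, one_mul]
  exact ⟨zero_le_one, by nlinarith⟩

theorem exists_discounted_beta_le (h : MemED δ lam C₀ α β γ) (hδ : 0 < δ) (hC₀ : 0 < C₀)
    (h0 : α 0 + γ 0 ≤ 1) {ε : ℝ} (hε : 0 < ε) :
    ∃ s, 0 ≤ s ∧ s ≤ 1 / ε ∧ Real.exp (-δ * s) * β s ≤ 2 * C₀ * ε := by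
  by_contra! hlt
  have hb := h.integrableOn_discounted_beta hδ le_rfl
  have hT : 0 ≤ 1 / ε := by positivity
  have hlow : (∫ _ in (0 : ℝ)..1 / ε, 2 * C₀ * ε) ≤
      ∫ r in (0 : ℝ)..1 / ε, Real.exp (-δ * r) * β r :=
    intervalIntegral.integral_mono_on hT intervalIntegrable_const
      ((intervalIntegrable_iff_integrableOn_Ioc_of_le hT).2
        (hb.mono_set Set.Ioc_subset_Ioi_self)) fun r hr => (hlt r hr.1 hr.2).le
  have hup : (∫ r in (0 : ℝ)..1 / ε, Real.exp (-δ * r) * β r) ≤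
      ∫ r in Set.Ioi 0, Real.exp (-δ * r) * β r := by
    rw [intervalIntegral.integral_of_le hT]
    refine setIntegral_mono_set hb ?_ Set.Ioc_subset_Ioi_self.eventuallyLE
    filter_upwards [ae_restrict_mem measurableSet_Ioi] with r hr
    exact mul_nonneg (Real.exp_pos _).le (h.nonneg_beta r (le_of_lt hr))
  have hval : (∫ _ in (0 : ℝ)..1 / ε, 2 * C₀ * ε) = 2 * C₀ := by
    rw [intervalIntegral.integral_const, smul_eq_mul]
    field_simp
    ring
  linarith [h.integral_discounted_beta_le hC₀ h0]

end MemED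

/-- Interior smallness, discounted case: there exists `C > 0` depending only on `C₀`
and `λ` such that for every `ε ∈ (0, 1]`, every `δ ∈ (0, λ]`, every
`(α, β, γ) ∈ 𝓔(δ, λ, C₀)` with `α(0) + γ(0) ≤ 1`, and every `t ≥ 2/ε`,
`e^{-δt}(α(t) + γ(t)) ≤ C (e^{-λ/ε} + ε^{1/2})`. -/
theorem interior_smallness_discounted (lam C₀ : ℝ) (hlam : 0 < lam) (hC₀ : 0 < C₀) :
    ∃ C : ℝ, 0 < C ∧
      ∀ ε : ℝ, 0 < ε → ε ≤ 1 →
        ∀ δ : ℝ, 0 < δ → δ ≤ lam → ∀ α β γ : ℝ → ℝ, MemED δ lam C₀ α β γ →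
          α 0 + γ 0 ≤ 1 →
            ∀ t : ℝ, 2 / ε ≤ t →
              Real.exp (-δ * t) * (α t + γ t) ≤
                C * (Real.exp (-lam / ε) + Real.sqrt ε) := by
  set G := C₀ + C₀ ^ 2
  set K := (C₀ ^ 2 + C₀ ^ 3) ^ 2 + 2 * C₀ ^ 2
  set P := C₀ * G
  set Q := C₀ * (C₀ * √(2 * C₀ ^ 2 * G))
  refine ⟨(K + 1) * (P + Q), by positivity, ?_⟩
  intro ε hε _ δ hδ hδlam α β γ h h0 t ht
  obtain ⟨s, hs, hsε, hβ⟩ := h.exists_discounted_beta_le hδ hC₀ h0 hε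
  have hgap : 1 / ε ≤ t - s := by
    have : 2 / ε = 1 / ε + 1 / ε := by ring
    linarith
  have hst : s ≤ t := by
    have : 0 < 1 / ε := by positivity
    linarith
  have hα : Real.exp (-δ * s) * α s ≤ 2 * C₀ ^ 2 * ε := by
    nlinarith [mul_le_mul_of_nonneg_left (h.ineq4 s hs) (Real.exp_pos (-δ * s)).le]
  have hγ : Real.exp (-δ * s) * γ s ≤ G := by
    have h2 := h.discounted_ineq2 hδ hC₀ le_rfl hs
    have hB := h.integral_discounted_beta_le hC₀ h0
    have hγ0 : γ 0 ≤ 1 := by linarith [h.nonneg_alpha 0 le_rfl]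
    have hexp : Real.exp (-lam * (s - 0)) ≤ 1 := Real.exp_le_one_iff.2 (by nlinarith)
    have hγ0' := h.nonneg_gamma 0 le_rfl
    rw [mul_zero, Real.exp_zero, one_mul] at h2
    calc _ ≤ _ := h2
      _ ≤ C₀ * 1 * 1 + C₀ * C₀ := by gcongr
      _ = G := by ring
  have hγs := mul_nonneg (Real.exp_pos (-δ * s)).le (h.nonneg_gamma s hs)
  have hB : (∫ r in Set.Ioi s, Real.exp (-δ * r) * β r) ≤ C₀ * (√(2 * C₀ ^ 2 * G) * √ε) := by
    refine (h.discounted_ineq1 hs).trans ?_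
    rw [← Real.sqrt_mul (by positivity)]
    refine mul_le_mul_of_nonneg_left (Real.sqrt_le_sqrt ?_) hC₀.le
    rw [mul_right_comm _ G ε]
    exact mul_le_mul hα hγ hγs (by positivity)
  have hexp : Real.exp (-lam * (t - s)) ≤ Real.exp (-lam / ε) := by
    refine Real.exp_le_exp.2 ?_
    have : -lam / ε = -(lam * (1 / ε)) := by ring
    nlinarith
  have hγt : Real.exp (-δ * t) * γ t ≤ P * Real.exp (-lam / ε) + Q * √ε :=
    calc _ ≤ _ := h.discounted_ineq2 hδ hC₀ hs hst
      _ ≤ C₀ * Real.exp (-lam / ε) * G + C₀ * (C₀ * (√(2 * C₀ ^ 2 * G) * √ε)) := by gcongr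
      _ = _ := by ring
  have hαt := h.alpha_le_mul_gamma hδ hδlam hC₀ (hs.trans hst)
  calc Real.exp (-δ * t) * (α t + γ t)
      ≤ (K + 1) * (Real.exp (-δ * t) * γ t) := by linarith
    _ ≤ (K + 1) * (P * Real.exp (-lam / ε) + Q * √ε) := by gcongr
    _ ≤ (K + 1) * ((P + Q) * (Real.exp (-lam / ε) + √ε)) := by
        have hP : 0 ≤ P * √ε := by positivity
        have hQ : 0 ≤ Q * Real.exp (-lam / ε) := by positivity
        gcongr
        linarith
    _ = _ := by ring
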